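/- Let n ≥ 5 and let U be the standard bubble. For any real constants a_{ijkl} and b_{ij} (indices 1 ≤ i,j,k,l ≤ n-1) and any m ∈ {1,…,n-1}, one has ∫_{ℝⁿ₊} ( ∑_{i,j=1}^{n-1} [ ∑_{k,l=1}^{n-1} a_{ijkl}·y_k·y_l + b_{ij}·yₙ² ]·∂²U/∂y_i∂y_j(y) )·∂U/∂y_m(y) dy = 0. -/

import Mathlib

open MeasureTheory

noncomputable section

/-- The index of the last coordinate in `Fin n`. -/
def lastIdx (n : ℕ) [NeZero n] : Fin n :=
  ⟨n - 1, Nat.sub_lt (Nat.pos_of_ne_zero (NeZero.ne n)) Nat.one_pos⟩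

/-- The last coordinate `yₙ` of a point `y ∈ ℝⁿ`. -/
def lastCoord (n : ℕ) [NeZero n] (y : EuclideanSpace ℝ (Fin n)) : ℝ :=
  y (lastIdx n)

/-- `|ȳ|²`, the squared norm of the first `n-1` coordinates. -/
def barNormSq (n : ℕ) [NeZero n] (y : EuclideanSpace ℝ (Fin n)) : ℝ :=
  ∑ i : Fin n, if (i : ℕ) < n - 1 then (y i) ^ 2 else 0

/-- The standard bubble `U(y) = ((1+yₙ)² + |ȳ|²)^(-(n-2)/2)`. -/
def bubble (n : ℕ) [NeZero n] (y : EuclideanSpace ℝ (Fin n)) : ℝ :=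
  ((1 + lastCoord n y) ^ 2 + barNormSq n y) ^ (-((n : ℝ) - 2) / 2)

/-- The partial derivative `∂f/∂yᵢ`. -/
def partialDeriv (n : ℕ) (f : EuclideanSpace ℝ (Fin n) → ℝ) (i : Fin n)
    (y : EuclideanSpace ℝ (Fin n)) : ℝ :=
  fderiv ℝ f y (EuclideanSpace.single i 1)

/-- The closed upper half-space `ℝⁿ₊ = {y : yₙ ≥ 0}`. -/
def halfSpace (n : ℕ) [NeZero n] : Set (EuclideanSpace ℝ (Fin n)) :=
  {y | 0 ≤ lastCoord n y}

/-- The inclusion of a boundary index `i ∈ {1,…,n-1}` into `Fin n`. -/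
def bIdx (n : ℕ) (i : Fin (n - 1)) : Fin n := Fin.castLE (Nat.sub_le n 1) i

/-- The reflection of the first `n-1` coordinates. -/
def reflBar (n : ℕ) : EuclideanSpace ℝ (Fin n) ≃ₗᵢ[ℝ] EuclideanSpace ℝ (Fin n) :=
  LinearIsometryEquiv.piLpCongrRight 2
    (fun i : Fin n => if (i : ℕ) < n - 1 then LinearIsometryEquiv.neg ℝ
      else LinearIsometryEquiv.refl ℝ ℝ)

lemma reflBar_apply (n : ℕ) (y : EuclideanSpace ℝ (Fin n)) (i : Fin n) :
    reflBar n y i = if (i : ℕ) < n - 1 then - y i else y i := by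
  unfold reflBar
  rw [LinearIsometryEquiv.piLpCongrRight_apply]
  split_ifs with h <;> simp [h]

lemma reflBar_bIdx (n : ℕ) (y : EuclideanSpace ℝ (Fin n)) (i : Fin (n - 1)) :
    reflBar n y (bIdx n i) = - y (bIdx n i) := by
  rw [reflBar_apply, if_pos]
  simp [bIdx]

lemma reflBar_last (n : ℕ) [NeZero n] (y : EuclideanSpace ℝ (Fin n)) :
    lastCoord n (reflBar n y) = lastCoord n y := by
  unfold lastCoord
  rw [reflBar_apply, if_neg]
  simp [lastIdx]

lemma reflBar_single (n : ℕ) (i : Fin (n - 1)) :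
    reflBar n (EuclideanSpace.single (bIdx n i) 1) = - EuclideanSpace.single (bIdx n i) 1 := by
  ext j
  rw [reflBar_apply]
  by_cases h : j = bIdx n i
  · subst h
    simp [bIdx]
  · simp [h]

lemma bubble_reflBar (n : ℕ) [NeZero n] (y : EuclideanSpace ℝ (Fin n)) :
    bubble n (reflBar n y) = bubble n y := by
  unfold bubble barNormSq
  rw [reflBar_last]
  congr 2
  refine Finset.sum_congr rfl fun i _ => ?_
  rw [reflBar_apply]
  split_ifs <;> simp

lemma partialDeriv_reflBar (n : ℕ) (f : EuclideanSpace ℝ (Fin n) → ℝ) (c : ℝ)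
    (hf : ∀ y, f (reflBar n y) = c * f y) (i : Fin (n - 1)) (y : EuclideanSpace ℝ (Fin n)) :
    partialDeriv n f (bIdx n i) (reflBar n y) = -c * partialDeriv n f (bIdx n i) y := by
  unfold partialDeriv
  have h1 : f ∘ (reflBar n).toContinuousLinearEquiv = fun y => c • f y := by
    funext y
    exact hf y
  have h2 := (reflBar n).toContinuousLinearEquiv.comp_right_fderiv (f := f) (x := y)
  rw [h1] at h2
  have h3 := congrArg (fun L => L (EuclideanSpace.single (bIdx n i) (1 : ℝ))) h2
  have h4 : fderiv ℝ (fun y => c • f y) y = c • fderiv ℝ f y :=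
    congrFun (fderiv_const_smul_field (f := f) c) y
  rw [h4] at h3
  have h5 : c * fderiv ℝ f y (EuclideanSpace.single (bIdx n i) 1)
      = fderiv ℝ f (reflBar n y) (reflBar n (EuclideanSpace.single (bIdx n i) 1)) := h3
  rw [reflBar_single, map_neg] at h5
  linarith

/-- For any constants `a_{ijkl}`, `b_{ij}` (indices in `{1,…,n-1}`) and any
`m ∈ {1,…,n-1}`, one has
`∫_{ℝⁿ₊} (∑_{i,j} [∑_{k,l} a_{ijkl} y_k y_l + b_{ij} yₙ²] ∂²_{ij}U) ∂_m U dy = 0`. -/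
theorem statement18 (n : ℕ) [NeZero n] (hn : 5 ≤ n)
    (a : Fin (n - 1) → Fin (n - 1) → Fin (n - 1) → Fin (n - 1) → ℝ)
    (b : Fin (n - 1) → Fin (n - 1) → ℝ) (m : Fin (n - 1)) :
    ∫ y in halfSpace n,
      (∑ i : Fin (n - 1), ∑ j : Fin (n - 1),
          ((∑ k : Fin (n - 1), ∑ l : Fin (n - 1),
              a i j k l * y (bIdx n k) * y (bIdx n l))
            + b i j * (lastCoord n y) ^ 2)
          * partialDeriv n (partialDeriv n (bubble n) (bIdx n i)) (bIdx n j) y)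
        * partialDeriv n (bubble n) (bIdx n m) y = 0 := by
  set F : EuclideanSpace ℝ (Fin n) → ℝ := fun y =>
      (∑ i : Fin (n - 1), ∑ j : Fin (n - 1),
          ((∑ k : Fin (n - 1), ∑ l : Fin (n - 1),
              a i j k l * y (bIdx n k) * y (bIdx n l))
            + b i j * (lastCoord n y) ^ 2)
          * partialDeriv n (partialDeriv n (bubble n) (bIdx n i)) (bIdx n j) y)
        * partialDeriv n (bubble n) (bIdx n m) y with hF
  have h1 : ∀ (i : Fin (n - 1)) (y : EuclideanSpace ℝ (Fin n)),
      partialDeriv n (bubble n) (bIdx n i) (reflBar n y)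
        = -1 * partialDeriv n (bubble n) (bIdx n i) y := fun i y =>
    partialDeriv_reflBar n _ 1 (fun y => by rw [bubble_reflBar, one_mul]) i y
  have h2 : ∀ (i j : Fin (n - 1)) (y : EuclideanSpace ℝ (Fin n)),
      partialDeriv n (partialDeriv n (bubble n) (bIdx n i)) (bIdx n j) (reflBar n y)
        = partialDeriv n (partialDeriv n (bubble n) (bIdx n i)) (bIdx n j) y := fun i j y => by
    rw [partialDeriv_reflBar n _ (-1) (h1 i) j y]
    ring
  have hodd : ∀ y, F (reflBar n y) = - F y := by
    intro y
    simp only [hF, h1, h2, reflBar_bIdx, reflBar_last, mul_neg, neg_mul, neg_neg, one_mul]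
  have hpre : (reflBar n) ⁻¹' (halfSpace n) = halfSpace n := by
    ext y
    simp [halfSpace, reflBar_last]
  have h3 := (reflBar n).measurePreserving.setIntegral_preimage_emb
    (reflBar n).toHomeomorph.measurableEmbedding F (halfSpace n)
  rw [hpre] at h3
  simp only [hodd, integral_neg] at h3
  change ∫ y in halfSpace n, F y = 0
  linarith
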